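/- arXiv:1505.02417 — 5 statements merged into one kernel-verified Lean document; each statement's English description precedes it below -/
import Mathlib

section
/- Let ℓ : ℝ → ℝ be differentiable, x ∈ ℝ^p, γ > 0 and θ₀ ∈ ℝ^p. Then a vector θ₁ ∈ ℝ^p satisfies the implicit stochastic gradient update θ₁ = θ₀ − γ ℓ'(xᵀθ₁) x if and only if θ₁ = θ₀ − γ r x, where the scalar r = ℓ'(xᵀθ₁) satisfies the one-dimensional fixed-point equation r = ℓ'(xᵀθ₀ − γ ‖x‖² r). In particular, the gradient at the implicit update is colinear with the gradient at θ₀ whenever ℓ'(xᵀθ₀) ≠ 0: writing κ = ℓ'(xᵀθ₀) and s = r/κ, one has ℓ'(xᵀθ₁) x = s · ℓ'(xᵀθ₀) x and ℓ'(xᵀθ₀ − γ s κ ‖x‖² ) = s κ. -/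
open scoped RealInnerProductSpace

/-- Implicit SGD update for a generalized-linear loss `L(θ, ξ) = ℓ(xᵀθ)`:
the multidimensional fixed-point equation reduces to a one-dimensional one,
and the gradient at the implicit update is colinear with the gradient at `θ₀`. -/
theorem implicit_update_one_dimensional_reduction {p : ℕ} (l : ℝ → ℝ)
    (hl : Differentiable ℝ l) (x θ₀ θ₁ : EuclideanSpace ℝ (Fin p)) (γ : ℝ) (hγ : 0 < γ) :
    (θ₁ = θ₀ - (γ * deriv l ⟪x, θ₁⟫) • x ↔
      ∃ r : ℝ, r = deriv l ⟪x, θ₁⟫ ∧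
        r = deriv l (⟪x, θ₀⟫ - γ * ‖x‖ ^ 2 * r) ∧
        θ₁ = θ₀ - (γ * r) • x) ∧
    (deriv l ⟪x, θ₀⟫ ≠ 0 →
      θ₁ = θ₀ - (γ * deriv l ⟪x, θ₁⟫) • x →
      ∀ κ s : ℝ, κ = deriv l ⟪x, θ₀⟫ → s = deriv l ⟪x, θ₁⟫ / κ →
        deriv l ⟪x, θ₁⟫ • x = s • (deriv l ⟪x, θ₀⟫ • x) ∧
        deriv l (⟪x, θ₀⟫ - γ * (s * κ) * ‖x‖ ^ 2) = s * κ) := by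
  have inner_update : θ₁ = θ₀ - (γ * deriv l ⟪x, θ₁⟫) • x →
      ⟪x, θ₁⟫ = ⟪x, θ₀⟫ - γ * ‖x‖ ^ 2 * deriv l ⟪x, θ₁⟫ := fun h => by
    have h' := congrArg (fun v => ⟪x, v⟫) h
    simp only [inner_sub_right, real_inner_smul_right, real_inner_self_eq_norm_sq] at h'
    linear_combination h'
  refine ⟨⟨fun h => ⟨_, rfl, congrArg (deriv l) (inner_update h), h⟩, ?_⟩, ?_⟩
  · rintro ⟨r, rfl, -, h⟩
    exact h
  · rintro hne h κ s rfl rfl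
    rw [smul_smul, div_mul_cancel₀ _ hne]
    refine ⟨rfl, ?_⟩
    rw [mul_right_comm, ← inner_update h]
end

section
/- Let g : ℝ → ℝ be nonincreasing, let γ > 0, c ≥ 0, u₀ ∈ ℝ, and suppose u⋆ ∈ ℝ satisfies the fixed-point equation u⋆ = γ g(u₀ + c u⋆). Then u⋆ lies between 0 and γ g(u₀); explicitly: if g(u₀) > 0 then 0 < u⋆ ≤ γ g(u₀); if g(u₀) < 0 then γ g(u₀) ≤ u⋆ < 0; and if g(u₀) = 0 then u⋆ = 0. -/
/-- Search bounds for the one-dimensional fixed-point equation `u⋆ = γ g(u₀ + c u⋆)`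
arising from the implicit stochastic gradient update for a convex
generalized-linear loss: `u⋆` lies between `0` and `γ g(u₀)`. -/
theorem fixed_point_search_bounds (g : ℝ → ℝ) (hg : Antitone g)
    (γ c u₀ ustar : ℝ) (hγ : 0 < γ) (hc : 0 ≤ c)
    (hfix : ustar = γ * g (u₀ + c * ustar)) :
    (0 < g u₀ → 0 < ustar ∧ ustar ≤ γ * g u₀) ∧
    (g u₀ < 0 → γ * g u₀ ≤ ustar ∧ ustar < 0) ∧
    (g u₀ = 0 → ustar = 0) := by
  have upper (hu : 0 ≤ ustar) : ustar ≤ γ * g u₀ :=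
    hfix.le.trans <| mul_le_mul_of_nonneg_left
      (hg (le_add_of_nonneg_right (mul_nonneg hc hu))) hγ.le
  have lower (hu : ustar ≤ 0) : γ * g u₀ ≤ ustar :=
    (mul_le_mul_of_nonneg_left
      (hg (add_le_of_nonpos_right (mul_nonpos_of_nonneg_of_nonpos hc hu))) hγ.le).trans hfix.ge
  refine ⟨fun h => ?_, fun h => ?_, fun h => ?_⟩
  · have pos : 0 < ustar := by
      by_contra! hu
      exact ((mul_pos hγ h).trans_le (lower hu)).not_ge hu
    exact ⟨pos, upper pos.le⟩
  · have neg : ustar < 0 := by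
      by_contra! hu
      exact ((upper hu).trans_lt (mul_neg_of_pos_of_neg hγ h)).not_ge hu
    exact ⟨lower neg.le, neg⟩
  · rw [h, mul_zero] at upper lower
    rcases le_total 0 ustar with hu | hu
    · exact le_antisymm (upper hu) hu
    · exact le_antisymm hu (lower hu)
end

section
/- Let a_n = a₁ n^{-α} and b_n = b₁ n^{-β} with a₁, b₁, β > 0, max{β, 1} < α < 1 + β, and β ≠ 1, and let c_n = 0. Suppose (y_n)_{n≥0} is a positive sequence satisfying y_n ≤ (1/(1 + b_n)) y_{n-1} + a_n for all n ≥ 1. Then there exists n₀ > 0 such that for all sufficiently large n: y_n ≤ 2 (a₁ (1 + b₁)/b₁) n^{-α+β} + exp(−log(1 + b₁) · n^{1−β}) · [y₀ + (1 + b₁)^{n₀} A], where A = Σ_{i=1}^∞ a_i < ∞. (If β = 1, the same bound holds with n^{1−β} replaced by log n.) -/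
open Filter Topology

/-- The difference of consecutive values of `x ↦ x ^ (-γ)` is `O(x ^ (-γ - 1))`. -/
lemma rpow_neg_sub_rpow_neg_add_one_le {x γ : ℝ} (hx : 1 ≤ x) (hγ : 0 ≤ γ) (hγ1 : γ ≤ 1) :
    x ^ (-γ) - (x + 1) ^ (-γ) ≤ 2 * ((x + 1) ^ (-γ) * (x + 1)⁻¹) := by
  have hx0 : 0 < x := by linarith
  have hbern : (1 + x⁻¹) ^ γ ≤ 1 + γ * x⁻¹ :=
    rpow_one_add_le_one_add_mul_self (by have := inv_pos.2 hx0; linarith) hγ hγ1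
  have hfac : x ^ (-γ) = (x + 1) ^ (-γ) * (1 + x⁻¹) ^ γ := by
    have : x + 1 = x * (1 + x⁻¹) := by field_simp
    rw [this, Real.mul_rpow hx0.le (by positivity), mul_assoc,
      ← Real.rpow_add (by positivity), neg_add_cancel, Real.rpow_zero, mul_one]
  have hinv : γ * x⁻¹ ≤ 2 * (x + 1)⁻¹ := by
    calc γ * x⁻¹ ≤ 1 * x⁻¹ := by gcongr
      _ ≤ 2 * (x + 1)⁻¹ := by
        rw [one_mul, ← div_eq_mul_inv, inv_eq_one_div, div_le_div_iff₀ hx0 (by linarith)]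
        linarith
  have hpos : 0 ≤ (x + 1) ^ (-γ) := by positivity
  rw [hfac]
  nlinarith

/-- The discounting product of the factors `1 + b₁ i ^ (-β)` over `1 ≤ i ≤ n`. -/
noncomputable def discountProd (b₁ β : ℝ) (n : ℕ) : ℝ :=
  ∏ i ∈ Finset.range n, (1 + b₁ * ((i : ℝ) + 1) ^ (-β))

lemma discountProd_succ (b₁ β : ℝ) (n : ℕ) :
    discountProd b₁ β (n + 1) = discountProd b₁ β n * (1 + b₁ * ((n : ℝ) + 1) ^ (-β)) :=
  Finset.prod_range_succ _ _

lemma discountProd_pos {b₁ : ℝ} (hb₁ : 0 < b₁) (β : ℝ) (n : ℕ) : 0 < discountProd b₁ β n :=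
  Finset.prod_pos fun i _ => by positivity

lemma natCast_add_one_rpow_neg_le_one {β : ℝ} (hβ : 0 ≤ β) (i : ℕ) :
    ((i : ℝ) + 1) ^ (-β) ≤ 1 :=
  Real.rpow_le_one_of_one_le_of_nonpos (by have := i.cast_nonneg (α := ℝ); linarith)
    (by linarith)

lemma discountProd_le_pow {b₁ β : ℝ} (hb₁ : 0 < b₁) (hβ : 0 ≤ β) (n : ℕ) :
    discountProd b₁ β n ≤ (1 + b₁) ^ n := by
  calc discountProd b₁ β n ≤ ∏ _i ∈ Finset.range n, (1 + b₁) :=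
        Finset.prod_le_prod (fun i _ => by positivity) fun i _ => by
          have := mul_le_mul_of_nonneg_left (natCast_add_one_rpow_neg_le_one hβ i) hb₁.le
          linarith
    _ = (1 + b₁) ^ n := by simp

lemma exp_log_mul_rpow_le_discountProd {b₁ β : ℝ} (hb₁ : 0 < b₁) (hβ : 0 ≤ β) {n : ℕ}
    (hn : 1 ≤ n) :
    Real.exp (Real.log (1 + b₁) * (n : ℝ) ^ (1 - β)) ≤ discountProd b₁ β n := by
  have hn1 : (1 : ℝ) ≤ n := by exact_mod_cast hn
  have hn0 : (0 : ℝ) < n := by linarith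
  have hpow : (n : ℝ) ^ (1 - β) = (n : ℝ) ^ (-β) * n := by
    rw [sub_eq_neg_add, Real.rpow_add hn0, Real.rpow_one]
  calc Real.exp (Real.log (1 + b₁) * (n : ℝ) ^ (1 - β))
      = ∏ _i ∈ Finset.range n, (1 + b₁) ^ ((n : ℝ) ^ (-β)) := by
        rw [Finset.prod_const, Finset.card_range, ← Real.rpow_mul_natCast (by linarith),
          ← hpow, Real.rpow_def_of_pos (show 0 < 1 + b₁ by linarith)]
    _ ≤ discountProd b₁ β n := by
        refine Finset.prod_le_prod (fun i _ => by positivity) fun i hi => ?_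
        have hbern : (1 + b₁) ^ ((n : ℝ) ^ (-β)) ≤ 1 + (n : ℝ) ^ (-β) * b₁ :=
          rpow_one_add_le_one_add_mul_self (by linarith) (by positivity)
            (Real.rpow_le_one_of_one_le_of_nonpos hn1 (by linarith))
        have hi' : (i : ℝ) + 1 ≤ n := by exact_mod_cast Finset.mem_range.1 hi
        have hmono : (n : ℝ) ^ (-β) ≤ ((i : ℝ) + 1) ^ (-β) :=
          Real.rpow_le_rpow_of_nonpos (by positivity) hi' (by linarith)
        nlinarith

/-- Eventually `n ↦ K n ^ (-α + β)`, with `K = 2 a₁ (1 + b₁) / b₁`, is a supersolution of the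
recursion. -/
lemma eventually_supersolution {a₁ b₁ α β : ℝ} (ha₁ : 0 < a₁) (hb₁ : 0 < b₁) (hβ : 0 < β)
    (hβα : β ≤ α) (hα : α ≤ 1 + β) (hβ1 : β < 1) :
    ∀ᶠ n : ℕ in atTop,
      2 * (a₁ * (1 + b₁) / b₁) * (n : ℝ) ^ (-α + β) +
          (1 + b₁ * ((n : ℝ) + 1) ^ (-β)) * (a₁ * ((n : ℝ) + 1) ^ (-α)) ≤
        (1 + b₁ * ((n : ℝ) + 1) ^ (-β)) *
          (2 * (a₁ * (1 + b₁) / b₁) * ((n : ℝ) + 1) ^ (-α + β)) := by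
  have hlim : Tendsto (fun n : ℕ => ((n : ℝ) + 1) ^ (1 - β)) atTop atTop :=
    (tendsto_rpow_atTop (by linarith)).comp
      (tendsto_atTop_add_const_right _ 1 tendsto_natCast_atTop_atTop)
  filter_upwards [hlim.eventually_ge_atTop (4 / b₁), eventually_ge_atTop 1] with n hlarge hn
  have hn1 : (1 : ℝ) ≤ n := by exact_mod_cast hn
  have hx : (0 : ℝ) < (n : ℝ) + 1 := by linarith
  have hdiff := rpow_neg_sub_rpow_neg_add_one_le (γ := α - β) hn1 (by linarith) (by linarith)
  rw [neg_sub, sub_eq_neg_add β α] at hdiff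
  have hprod : ((n : ℝ) + 1) ^ (-β) * ((n : ℝ) + 1) ^ (-α + β) = ((n : ℝ) + 1) ^ (-α) := by
    rw [← Real.rpow_add hx]; congr 1; ring
  have hinv : ((n : ℝ) + 1) ^ (-α + β) * ((n : ℝ) + 1)⁻¹ * ((n : ℝ) + 1) ^ (1 - β) =
      ((n : ℝ) + 1) ^ (-α) := by
    rw [← Real.rpow_neg_one, ← Real.rpow_add hx, ← Real.rpow_add hx]; congr 1; ring
  have hle1 : ((n : ℝ) + 1) ^ (-β) ≤ 1 := natCast_add_one_rpow_neg_le_one hβ.le n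
  set u := ((n : ℝ) + 1) ^ (-α + β)
  set v := ((n : ℝ) + 1) ^ (-β)
  set w := ((n : ℝ) + 1) ^ (-α)
  set q := u * ((n : ℝ) + 1)⁻¹
  have hq : 0 ≤ q := by positivity
  have hw : 0 ≤ w := by positivity
  have hq4 : 4 * q ≤ b₁ * w := by
    rw [div_le_iff₀ hb₁] at hlarge
    calc 4 * q ≤ ((n : ℝ) + 1) ^ (1 - β) * b₁ * q := by gcongr
      _ = b₁ * w := by rw [← hinv]; ring
  have hK : a₁ * (1 + b₁) / b₁ * b₁ = a₁ * (1 + b₁) := by field_simp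
  have hK0 : 0 ≤ a₁ * (1 + b₁) / b₁ := by positivity
  set K := a₁ * (1 + b₁) / b₁
  have hbv : (1 + b₁ * v) * (a₁ * w) ≤ (1 + b₁) * (a₁ * w) := by
    gcongr
    nlinarith
  calc 2 * K * (n : ℝ) ^ (-α + β) + (1 + b₁ * v) * (a₁ * w)
      ≤ 2 * K * (u + b₁ * w / 2) + (1 + b₁) * (a₁ * w) := by
        gcongr
        linarith
    _ = 2 * K * u + 2 * (K * b₁) * w := by rw [hK]; linear_combination w * hK
    _ = (1 + b₁ * v) * (2 * K * u) := by rw [← hprod]; ring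

/-- Specialization of the master recursion lemma to polynomially decaying sequences
`a_n = a₁ n^{-α}`, `b_n = b₁ n^{-β}`, `c_n = 0`: the rate `n^{-α+β}` with
exponential discounting of the initial condition `y₀`. -/
theorem recursion_polynomial_rates (a₁ b₁ α β : ℝ)
    (ha₁ : 0 < a₁) (hb₁ : 0 < b₁) (hβ : 0 < β)
    (hαβ : max β 1 < α) (hα : α < 1 + β) (hβ1 : β ≠ 1)
    (y : ℕ → ℝ) (hy : ∀ n, 0 < y n)
    (hrec : ∀ n ≥ 1,
      y n ≤ (1 / (1 + b₁ * (n : ℝ) ^ (-β))) * y (n - 1) + a₁ * (n : ℝ) ^ (-α))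
    (A : ℝ) (hA : A = ∑' i : ℕ, a₁ * ((i : ℝ) + 1) ^ (-α)) :
    ∃ n₀ : ℕ, 0 < n₀ ∧ ∃ N : ℕ, ∀ n ≥ N,
      y n ≤ 2 * (a₁ * (1 + b₁) / b₁) * (n : ℝ) ^ (-α + β) +
        Real.exp (-Real.log (1 + b₁) * (n : ℝ) ^ (1 - β)) *
          (y 0 + (1 + b₁) ^ n₀ * A) := by
  have hstep : ∀ n : ℕ, (1 + b₁ * ((n : ℝ) + 1) ^ (-β)) * y (n + 1) ≤
      y n + (1 + b₁ * ((n : ℝ) + 1) ^ (-β)) * (a₁ * ((n : ℝ) + 1) ^ (-α)) := by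
    intro n
    have h := hrec (n + 1) (by omega)
    push_cast at h
    have hpos : 0 < 1 + b₁ * ((n : ℝ) + 1) ^ (-β) := by positivity
    calc _ ≤ (1 + b₁ * ((n : ℝ) + 1) ^ (-β)) * (1 / (1 + b₁ * ((n : ℝ) + 1) ^ (-β)) * y n +
          a₁ * ((n : ℝ) + 1) ^ (-α)) := by gcongr
      _ = _ := by rw [mul_add, ← mul_assoc, mul_one_div_cancel hpos.ne', one_mul]
  have hsummable : Summable fun i : ℕ => a₁ * ((i : ℝ) + 1) ^ (-α) := by
    have h := (summable_nat_add_iff 1).2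
      (Real.summable_nat_rpow.2 (show -α < -1 by have := le_max_right β 1; linarith))
    push_cast at h
    exact h.mul_left a₁
  have hpartial : ∀ n : ℕ, ∑ i ∈ Finset.range n, a₁ * ((i : ℝ) + 1) ^ (-α) ≤ A := fun n =>
    hA ▸ hsummable.sum_le_tsum _ fun i _ => by positivity
  have hA0 : 0 < A := by
    have := hpartial 1
    simp at this
    linarith
  rcases lt_or_gt_of_ne hβ1 with hβ1 | hβ1
  · have hbound : ∀ n : ℕ, discountProd b₁ β n * y n ≤
        y 0 + (1 + b₁) ^ n * ∑ i ∈ Finset.range n, a₁ * ((i : ℝ) + 1) ^ (-α) := by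
      intro n
      induction n with
      | zero => simp [discountProd]
      | succ n ih =>
        have hs := mul_le_mul_of_nonneg_left (hstep n) (discountProd_pos hb₁ β n).le
        have hsum : 0 ≤ ∑ i ∈ Finset.range n, a₁ * ((i : ℝ) + 1) ^ (-α) :=
          Finset.sum_nonneg fun i _ => by positivity
        have hpow : (1 + b₁) ^ n ≤ (1 + b₁) ^ (n + 1) :=
          pow_le_pow_right₀ (by linarith) (Nat.le_succ n)
        have hterm : 0 ≤ a₁ * ((n : ℝ) + 1) ^ (-α) := by positivity
        have h1 := mul_le_mul_of_nonneg_right hpow hsum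
        have h2 := mul_le_mul_of_nonneg_right (discountProd_le_pow hb₁ hβ.le (n + 1)) hterm
        rw [discountProd_succ] at h2 ⊢
        rw [Finset.sum_range_succ]
        linarith
    obtain ⟨m, hm⟩ := eventually_atTop.1 (eventually_supersolution ha₁ hb₁ hβ
      ((le_max_left β 1).trans hαβ.le) hα.le hβ1)
    refine ⟨m + 1, m.succ_pos, m + 1, fun n hn => ?_⟩
    set z : ℕ → ℝ := fun n => 2 * (a₁ * (1 + b₁) / b₁) * (n : ℝ) ^ (-α + β) with hz
    have hdecr : discountProd b₁ β n * (y n - z n) ≤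
        discountProd b₁ β (m + 1) * (y (m + 1) - z (m + 1)) := by
      induction n, hn using Nat.le_induction with
      | base => exact le_rfl
      | succ k hk ih =>
        refine le_trans ?_ ih
        rw [discountProd_succ, mul_assoc]
        refine mul_le_mul_of_nonneg_left ?_ (discountProd_pos hb₁ β k).le
        have h1 := hstep k
        have h2 := hm k (by omega)
        simp only [hz, Nat.cast_add, Nat.cast_one]
        linarith
    have hz0 : 0 ≤ z (m + 1) := by positivity
    have hstart : discountProd b₁ β (m + 1) * (y (m + 1) - z (m + 1)) ≤
        y 0 + (1 + b₁) ^ (m + 1) * A := by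
      have h1 := hbound (m + 1)
      have h2 := mul_le_mul_of_nonneg_left (hpartial (m + 1))
        (show 0 ≤ (1 + b₁) ^ (m + 1) by positivity)
      have h3 := mul_nonneg (discountProd_pos hb₁ β (m + 1)).le hz0
      linarith
    have hgrow := exp_log_mul_rpow_le_discountProd hb₁ hβ.le (show 1 ≤ n by omega)
    have hB : 0 ≤ y 0 + (1 + b₁) ^ (m + 1) * A := by have := hy 0; positivity
    have hgap : y n - z n ≤
        Real.exp (-Real.log (1 + b₁) * (n : ℝ) ^ (1 - β)) * (y 0 + (1 + b₁) ^ (m + 1) * A) := by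
      rw [neg_mul, Real.exp_neg, inv_mul_eq_div]
      calc y n - z n ≤ (y 0 + (1 + b₁) ^ (m + 1) * A) / discountProd b₁ β n := by
            rw [le_div_iff₀ (discountProd_pos hb₁ β n), mul_comm]
            exact hdecr.trans hstart
        _ ≤ _ := by gcongr
    simp only [hz] at hgap
    linarith
  · have hbound : ∀ n : ℕ, y n ≤
        y 0 + ∑ i ∈ Finset.range n, a₁ * ((i : ℝ) + 1) ^ (-α) := by
      intro n
      induction n with
      | zero => simp
      | succ n ih =>
        rw [Finset.sum_range_succ]
        have h := hrec (n + 1) (by omega)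
        push_cast at h
        have hfac : 1 / (1 + b₁ * ((n : ℝ) + 1) ^ (-β)) ≤ 1 :=
          div_le_one_of_le₀ (le_add_of_nonneg_right (by positivity)) (by positivity)
        have := mul_le_of_le_one_left (hy n).le hfac
        linarith
    have hlim : Tendsto (fun n : ℕ => Real.exp (-Real.log (1 + b₁) * (n : ℝ) ^ (1 - β)) *
        (y 0 + (1 + b₁) ^ 1 * A)) atTop (𝓝 (y 0 + (1 + b₁) ^ 1 * A)) := by
      have h0 : Tendsto (fun n : ℕ => (n : ℝ) ^ (1 - β)) atTop (𝓝 0) := by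
        rw [← neg_sub β 1]
        exact (tendsto_rpow_neg_atTop (by linarith)).comp tendsto_natCast_atTop_atTop
      have h1 := (Real.continuous_exp.tendsto _).comp (h0.const_mul (-Real.log (1 + b₁)))
      rw [mul_zero, Real.exp_zero] at h1
      simpa only [one_mul, Function.comp_apply] using h1.mul_const (y 0 + (1 + b₁) ^ 1 * A)
    obtain ⟨N, hN⟩ := eventually_atTop.1 (hlim.eventually_const_le
      (show y 0 + A < y 0 + (1 + b₁) ^ 1 * A by nlinarith))
    refine ⟨1, one_pos, N, fun n hn => ?_⟩
    have h1 := hN n hn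
    have h2 := hbound n
    have h3 := hpartial n
    have h4 : 0 ≤ 2 * (a₁ * (1 + b₁) / b₁) * (n : ℝ) ^ (-α + β) := by positivity
    linarith
end

section
/- Let ℓ : ℝ → ℝ be twice continuously differentiable with ℓ'' ≥ 0, let x ∈ ℝ^p, γ > 0, θ₀ ∈ ℝ^p, and suppose ℓ''(u) ‖x‖² ≤ λ̄_f for all u ∈ ℝ, where λ̄_f > 0. Let θ₁ satisfy the implicit update θ₁ = θ₀ − γ ℓ'(xᵀθ₁) x, suppose κ := ℓ'(xᵀθ₀) ≠ 0, and define the scalar s by ℓ'(xᵀθ₁) = s κ. Then 1/(1 + γ λ̄_f) ≤ s ≤ 1. -/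
open scoped RealInnerProductSpace

/-- Mean value theorem for a differentiable function, with no order assumed on the endpoints. -/
theorem exists_sub_eq_deriv_mul_sub {f : ℝ → ℝ} (hf : Differentiable ℝ f) (a b : ℝ) :
    ∃ c, f b - f a = deriv f c * (b - a) := by
  rcases lt_trichotomy a b with h | rfl | h
  · obtain ⟨c, -, hc⟩ := exists_deriv_eq_slope f h hf.continuous.continuousOn hf.differentiableOn
    exact ⟨c, by rw [hc, div_mul_cancel₀ _ (sub_ne_zero.2 h.ne')]⟩
  · exact ⟨a, by simp⟩
  · obtain ⟨c, -, hc⟩ := exists_deriv_eq_slope f h hf.continuous.continuousOn hf.differentiableOn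
    refine ⟨c, ?_⟩
    rw [← neg_sub a b, mul_neg, hc, div_mul_cancel₀ _ (sub_ne_zero.2 h.ne'), neg_sub]

/-- Bounds on the implicit shrinkage factor `s` for a convex generalized-linear loss:
if the trace of the observed Fisher information is bounded by `λ̄_f`, then
`1/(1 + γ λ̄_f) ≤ s ≤ 1`. -/
theorem implicit_shrinkage_factor_bounds {p : ℕ} (l : ℝ → ℝ)
    (hl : ContDiff ℝ 2 l) (hconv : ∀ u : ℝ, 0 ≤ deriv (deriv l) u)
    (x θ₀ θ₁ : EuclideanSpace ℝ (Fin p)) (γ : ℝ) (hγ : 0 < γ)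
    (lamfbar : ℝ) (hlamfbar : 0 < lamfbar)
    (htrace : ∀ u : ℝ, deriv (deriv l) u * ‖x‖ ^ 2 ≤ lamfbar)
    (hupd : θ₁ = θ₀ - (γ * deriv l ⟪x, θ₁⟫) • x)
    (κ : ℝ) (hκdef : κ = deriv l ⟪x, θ₀⟫) (hκ : κ ≠ 0)
    (s : ℝ) (hs : deriv l ⟪x, θ₁⟫ = s * κ) :
    1 / (1 + γ * lamfbar) ≤ s ∧ s ≤ 1 := by
  have hdiff : Differentiable ℝ (deriv l) :=
    (hl.iterate_deriv' 1 1).differentiable one_ne_zero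
  have hstep : ⟪x, θ₀⟫ - ⟪x, θ₁⟫ = γ * (s * κ) * ‖x‖ ^ 2 := by
    have h := congrArg (fun v => ⟪x, v⟫) hupd
    simp only [inner_sub_right, inner_smul_right, real_inner_self_eq_norm_sq, hs] at h
    linarith
  obtain ⟨c, hc⟩ := exists_sub_eq_deriv_mul_sub hdiff ⟪x, θ₁⟫ ⟪x, θ₀⟫
  rw [← hκdef, hs, hstep] at hc
  have ht0 : 0 ≤ deriv (deriv l) c * ‖x‖ ^ 2 := mul_nonneg (hconv c) (sq_nonneg _)
  have ht1 := htrace c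
  set t := deriv (deriv l) c * ‖x‖ ^ 2 with ht
  have hγt : 0 ≤ γ * t := mul_nonneg hγ.le ht0
  have hst : s * (1 + γ * t) = 1 := mul_right_cancel₀ hκ (by rw [ht]; linear_combination -hc)
  rw [eq_one_div_of_mul_eq_one_left hst]
  exact ⟨by gcongr, (div_le_one (by positivity)).2 (by linarith)⟩
end

section
/- Let f : ℝ^p → ℝ be differentiable, let θ⋆ ∈ ℝ^p and μ > 0 be such that ⟨θ − θ⋆, ∇f(θ)⟩ ≥ (μ/2) ‖θ − θ⋆‖² for all θ ∈ ℝ^p, and let γ > 0. If θ₁ ∈ ℝ^p satisfies the implicit update equation θ₁ + γ ∇f(θ₁) = θ₀, then ‖θ₁ − θ⋆‖² ≤ (1/(1 + γμ)) ‖θ₀ − θ⋆‖². In particular, the implicit update contracts the distance to θ⋆ for every choice of learning rate γ > 0. -/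
open scoped RealInnerProductSpace

/-- The implicit update `θ₁ + γ ∇f(θ₁) = θ₀` contracts the distance to `θ⋆`
for every learning rate `γ > 0`, under the strong-convexity-type condition
`⟨θ − θ⋆, ∇f(θ)⟩ ≥ (μ/2)‖θ − θ⋆‖²`. -/
theorem implicit_update_contracts {p : ℕ} (f : EuclideanSpace ℝ (Fin p) → ℝ)
    (hf : Differentiable ℝ f) (θstar : EuclideanSpace ℝ (Fin p))
    (μ : ℝ) (hμ : 0 < μ)
    (hconv : ∀ θ : EuclideanSpace ℝ (Fin p),
      (μ / 2) * ‖θ - θstar‖ ^ 2 ≤ ⟪θ - θstar, gradient f θ⟫)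
    (γ : ℝ) (hγ : 0 < γ) (θ₀ θ₁ : EuclideanSpace ℝ (Fin p))
    (hupd : θ₁ + γ • gradient f θ₁ = θ₀) :
    ‖θ₁ - θstar‖ ^ 2 ≤ (1 / (1 + γ * μ)) * ‖θ₀ - θstar‖ ^ 2 := by
  have hd : θ₀ - θstar = (θ₁ - θstar) + γ • gradient f θ₁ := by
    rw [← hupd]
    abel
  have hpos : 0 < 1 + γ * μ := by positivity
  rw [one_div_mul_eq_div, le_div_iff₀ hpos, hd, norm_add_sq_real, real_inner_smul_right]
  linarith [mul_le_mul_of_nonneg_left (hconv θ₁) hγ.le, sq_nonneg ‖γ • gradient f θ₁‖]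
end
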